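/- Let K be an n-dimensional finite simplicial complex such that for every nonempty simplex σ ∈ K, the reduced cohomology H̃^i(link_K σ; G) vanishes whenever i ≠ n − |σ|. Then the cohomeology groups satisfy 𝓗^{p,q}(K;G) = 0 for q < n, and 𝓗^{p,n}(K;G) ≅ H^{n-p}(K;G). -/

import Mathlib

open Finset

/-- A finite abstract simplicial complex with vertices in `ℕ`. -/
structure SC where
  faces : Finset (Finset ℕ)
  down_closed : ∀ ⦃s t : Finset ℕ⦄, s ∈ faces → t ⊆ s → t ∈ faces

namespace SC

/-- The vertex set of a simplicial complex. -/
def verts (K : SC) : Finset ℕ := K.faces.sup id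

/-- The dimension of a simplicial complex (dimension of `{∅}` is `-1`). -/
def dim (K : SC) : ℤ := ((K.faces.sup Finset.card : ℕ) : ℤ) - 1

/-- The link of a simplex. -/
def link (K : SC) (σ : Finset ℕ) : SC where
  faces := K.faces.filter fun t => σ ∪ t ∈ K.faces ∧ Disjoint σ t
  down_closed := by
    intro s t hs hts
    simp only [mem_filter] at hs ⊢
    refine ⟨K.down_closed hs.1 hts, K.down_closed hs.2.1 (union_subset_union_right hts),
      hs.2.2.mono_right ?_⟩
    exact_mod_cast hts

/-- `K₁` is a subcomplex of `K`. -/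
def IsSub (K₁ K : SC) : Prop := K₁.faces ⊆ K.faces

/-- Union of two simplicial complexes. -/
def union (K L : SC) : SC where
  faces := K.faces ∪ L.faces
  down_closed := by
    intro s t hs hts
    rcases mem_union.mp hs with h | h
    · exact mem_union_left _ (K.down_closed h hts)
    · exact mem_union_right _ (L.down_closed h hts)

/-- Intersection of two simplicial complexes. -/
def inter (K L : SC) : SC where
  faces := K.faces ∩ L.faces
  down_closed := by
    intro s t hs hts
    rw [mem_inter] at hs ⊢
    exact ⟨K.down_closed hs.1 hts, L.down_closed hs.2 hts⟩

/-- The join of two simplicial complexes. -/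
def join (K L : SC) : SC where
  faces := (K.faces ×ˢ L.faces).image fun x => x.1 ∪ x.2
  down_closed := by
    intro s t hs hts
    simp only [mem_image, mem_product] at hs ⊢
    obtain ⟨⟨a, b⟩, ⟨ha, hb⟩, rfl⟩ := hs
    refine ⟨⟨t ∩ a, t \ a⟩, ⟨K.down_closed ha inter_subset_right,
      L.down_closed hb fun x hx => ?_⟩, ?_⟩
    · rcases mem_union.mp (hts (mem_sdiff.mp hx).1) with h | h
      · exact absurd h (mem_sdiff.mp hx).2
      · exact h
    · ext x
      simp only [mem_union, mem_inter, mem_sdiff]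
      constructor
      · rintro (⟨h, _⟩ | ⟨h, _⟩) <;> exact h
      · intro hx
        by_cases hxa : x ∈ a
        · exact Or.inl ⟨hx, hxa⟩
        · exact Or.inr ⟨hx, hxa⟩

end SC
namespace SC
open Finset

/-- The sign of a vertex `v` in a simplex, given by its position in the canonical ordering. -/
def psgn (v : ℕ) (s : Finset ℕ) : ℤ := (-1) ^ (s.filter fun u => u < v).card

variable (G : Type) [AddCommGroup G]

/-- The submodule of functions supported on a given set of indices. -/
def suppM {α : Type} (P : α → Prop) : Submodule ℤ (α → G) where
  carrier := {c | ∀ x, c x ≠ 0 → P x}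
  add_mem' := by
    intro a b ha hb x hx
    by_cases h : a x = 0
    · exact hb x (by simpa [h] using hx)
    · exact ha x h
  zero_mem' := fun x hx => absurd rfl hx
  smul_mem' := by
    intro z a ha x hx
    exact ha x fun h => hx (by simp [h])

end SC
namespace SC
open Finset

variable (G : Type) [AddCommGroup G]

/-- The unreduced simplicial coboundary (as a map on coefficient functions). -/
def cobF (K : SC) (c : Finset ℕ → G) : Finset ℕ → G := fun ρ =>
  if ρ ∈ K.faces then
    ∑ w ∈ ρ, if ρ.erase w = ∅ then 0 else psgn w ρ • c (ρ.erase w)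
  else 0

/-- The reduced simplicial coboundary. -/
def cobRF (K : SC) (c : Finset ℕ → G) : Finset ℕ → G := fun ρ =>
  if ρ ∈ K.faces then ∑ w ∈ ρ, psgn w ρ • c (ρ.erase w) else 0

/-- The unreduced simplicial coboundary as a linear map. -/
def cobL (K : SC) : (Finset ℕ → G) →ₗ[ℤ] (Finset ℕ → G) where
  toFun := cobF G K
  map_add' := by
    intro a b
    funext ρ
    simp only [cobF, Pi.add_apply]
    split_ifs with h
    · rw [← Finset.sum_add_distrib]
      refine Finset.sum_congr rfl fun w _ => ?_
      split_ifs with h2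
      · simp
      · simp [smul_add]
    · simp
  map_smul' := by
    intro z a
    funext ρ
    simp only [cobF, Pi.smul_apply, RingHom.id_apply]
    split_ifs with h
    · rw [Finset.smul_sum]
      refine Finset.sum_congr rfl fun w _ => ?_
      split_ifs with h2
      · simp
      · rw [smul_smul, smul_smul, mul_comm]
    · simp

/-- The reduced simplicial coboundary as a linear map. -/
def cobRL (K : SC) : (Finset ℕ → G) →ₗ[ℤ] (Finset ℕ → G) where
  toFun := cobRF G K
  map_add' := by
    intro a b
    funext ρ
    simp only [cobRF, Pi.add_apply]
    split_ifs with h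
    · rw [← Finset.sum_add_distrib]
      exact Finset.sum_congr rfl fun w _ => smul_add _ _ _
    · simp
  map_smul' := by
    intro z a
    funext ρ
    simp only [cobRF, Pi.smul_apply, RingHom.id_apply]
    split_ifs with h
    · rw [Finset.smul_sum]
      refine Finset.sum_congr rfl fun w _ => ?_
      rw [smul_smul, smul_smul, mul_comm]
    · simp

/-- Degree-`q` unreduced simplicial cochains of `K` with coefficients in `G`. -/
def Cgr (K : SC) (q : ℤ) : Submodule ℤ (Finset ℕ → G) :=
  suppM G fun s => s ∈ K.faces ∧ s ≠ ∅ ∧ (s.card : ℤ) = q + 1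

/-- Degree-`q` reduced simplicial cochains (the empty simplex sits in degree `-1`). -/
def CgrR (K : SC) (q : ℤ) : Submodule ℤ (Finset ℕ → G) :=
  suppM G fun s => s ∈ K.faces ∧ (s.card : ℤ) = q + 1

/-- The degree-`q` simplicial cohomology of `K` with coefficients in `G`. -/
abbrev coh (K : SC) (q : ℤ) :=
  ↥(Cgr G K q ⊓ LinearMap.ker (cobL G K)) ⧸
    Submodule.comap (Cgr G K q ⊓ LinearMap.ker (cobL G K)).subtype
      (Submodule.map (cobL G K) (Cgr G K (q - 1)))

/-- The degree-`q` reduced simplicial cohomology of `K` with coefficients in `G`. -/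
abbrev cohR (K : SC) (q : ℤ) :=
  ↥(CgrR G K q ⊓ LinearMap.ker (cobRL G K)) ⧸
    Submodule.comap (CgrR G K q ⊓ LinearMap.ker (cobRL G K)).subtype
      (Submodule.map (cobRL G K) (CgrR G K (q - 1)))

end SC
namespace SC
open Finset

/-- Pairs of simplices, indexing the double complex `N^{*,*}`. -/
abbrev Pr := Finset ℕ × Finset ℕ

variable (G : Type) [AddCommGroup G]

/-- The `(p,q)`-graded piece of the double complex `N^{*,*}(K)` spanned by `σ ⊗ τ`, `σ ⊆ τ`. -/
def Ngr (K : SC) (p q : ℤ) : Submodule ℤ (Pr → G) :=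
  suppM G fun x => x.1 ⊆ x.2 ∧ x.2 ∈ K.faces ∧ x.1 ≠ ∅ ∧
    (x.1.card : ℤ) = p + 1 ∧ (x.2.card : ℤ) = q + 1

/-- The `(p,q)`-graded piece of the reduced double complex `Ñ^{*,*}(K)`. -/
def NgrR (K : SC) (p q : ℤ) : Submodule ℤ (Pr → G) :=
  suppM G fun x => x.1 ⊆ x.2 ∧ x.2 ∈ K.faces ∧
    (x.1.card : ℤ) = p + 1 ∧ (x.2.card : ℤ) = q + 1

/-- The vertical differential `σ ⊗ τ ↦ (-1)^{|σ|} σ ⊗ δτ` (unreduced). -/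
def dvF (K : SC) (c : Pr → G) : Pr → G := fun x =>
  if x.2 ∈ K.faces ∧ x.1 ⊆ x.2 ∧ x.1 ≠ ∅ then
    ((-1 : ℤ) ^ x.1.card) •
      ∑ w ∈ x.2, if x.1 ⊆ x.2.erase w then psgn w x.2 • c (x.1, x.2.erase w) else 0
  else 0

/-- The horizontal differential `σ ⊗ τ ↦ dσ ⊗ τ` (unreduced). -/
def dhF (K : SC) (c : Pr → G) : Pr → G := fun x =>
  if x.2 ∈ K.faces ∧ x.1 ⊆ x.2 ∧ x.1 ≠ ∅ then
    ∑ v ∈ x.2 \ x.1, psgn v (insert v x.1) • c (insert v x.1, x.2)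
  else 0

/-- The vertical differential (reduced). -/
def dvRF (K : SC) (c : Pr → G) : Pr → G := fun x =>
  if x.2 ∈ K.faces ∧ x.1 ⊆ x.2 then
    ((-1 : ℤ) ^ x.1.card) •
      ∑ w ∈ x.2, if x.1 ⊆ x.2.erase w then psgn w x.2 • c (x.1, x.2.erase w) else 0
  else 0

/-- The horizontal differential (reduced). -/
def dhRF (K : SC) (c : Pr → G) : Pr → G := fun x =>
  if x.2 ∈ K.faces ∧ x.1 ⊆ x.2 then
    ∑ v ∈ x.2 \ x.1, psgn v (insert v x.1) • c (insert v x.1, x.2)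
  else 0

/-- The vertical differential as a linear map (unreduced). -/
def dvL (K : SC) : (Pr → G) →ₗ[ℤ] (Pr → G) where
  toFun := dvF G K
  map_add' := by
    intro a b
    funext x
    simp only [dvF, Pi.add_apply]
    split_ifs with h
    · rw [← smul_add, ← Finset.sum_add_distrib]
      congr 1
      refine Finset.sum_congr rfl fun w _ => ?_
      split_ifs with h2
      · simp [smul_add]
      · simp
    · simp
  map_smul' := by
    intro z a
    funext x
    simp only [dvF, Pi.smul_apply, RingHom.id_apply]
    split_ifs with h
    · rw [smul_comm z]
      congr 1
      rw [Finset.smul_sum]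
      refine Finset.sum_congr rfl fun w _ => ?_
      split_ifs with h2
      · rw [smul_smul, smul_smul, mul_comm]
      · simp
    · simp

/-- The horizontal differential as a linear map (unreduced). -/
def dhL (K : SC) : (Pr → G) →ₗ[ℤ] (Pr → G) where
  toFun := dhF G K
  map_add' := by
    intro a b
    funext x
    simp only [dhF, Pi.add_apply]
    split_ifs with h
    · rw [← Finset.sum_add_distrib]
      exact Finset.sum_congr rfl fun v _ => smul_add _ _ _
    · simp
  map_smul' := by
    intro z a
    funext x
    simp only [dhF, Pi.smul_apply, RingHom.id_apply]
    split_ifs with h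
    · rw [Finset.smul_sum]
      refine Finset.sum_congr rfl fun v _ => ?_
      rw [smul_smul, smul_smul, mul_comm]
    · simp

/-- The vertical differential as a linear map (reduced). -/
def dvRL (K : SC) : (Pr → G) →ₗ[ℤ] (Pr → G) where
  toFun := dvRF G K
  map_add' := by
    intro a b
    funext x
    simp only [dvRF, Pi.add_apply]
    split_ifs with h
    · rw [← smul_add, ← Finset.sum_add_distrib]
      congr 1
      refine Finset.sum_congr rfl fun w _ => ?_
      split_ifs with h2
      · simp [smul_add]
      · simp
    · simp
  map_smul' := by
    intro z a
    funext x
    simp only [dvRF, Pi.smul_apply, RingHom.id_apply]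
    split_ifs with h
    · rw [smul_comm z]
      congr 1
      rw [Finset.smul_sum]
      refine Finset.sum_congr rfl fun w _ => ?_
      split_ifs with h2
      · rw [smul_smul, smul_smul, mul_comm]
      · simp
    · simp

/-- The horizontal differential as a linear map (reduced). -/
def dhRL (K : SC) : (Pr → G) →ₗ[ℤ] (Pr → G) where
  toFun := dhRF G K
  map_add' := by
    intro a b
    funext x
    simp only [dhRF, Pi.add_apply]
    split_ifs with h
    · rw [← Finset.sum_add_distrib]
      exact Finset.sum_congr rfl fun v _ => smul_add _ _ _
    · simp
  map_smul' := by
    intro z a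
    funext x
    simp only [dhRF, Pi.smul_apply, RingHom.id_apply]
    split_ifs with h
    · rw [Finset.smul_sum]
      refine Finset.sum_congr rfl fun v _ => ?_
      rw [smul_smul, smul_smul, mul_comm]
    · simp

/-- The total differential `Δ(σ⊗τ) = dσ⊗τ + (-1)^{|σ|}σ⊗δτ` (unreduced). -/
def dL (K : SC) : (Pr → G) →ₗ[ℤ] (Pr → G) := dhL G K + dvL G K

/-- The total differential (reduced). -/
def dRL (K : SC) : (Pr → G) →ₗ[ℤ] (Pr → G) := dhRL G K + dvRL G K

/-- Cocycles for the `E₁`-page: `ker Δ_v` in bidegree `(p,q)`. -/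
def Z1 (K : SC) (p q : ℤ) : Submodule ℤ (Pr → G) :=
  Ngr G K p q ⊓ LinearMap.ker (dvL G K)

/-- Coboundaries for the `E₁`-page. -/
def B1 (K : SC) (p q : ℤ) : Submodule ℤ (Pr → G) :=
  Submodule.map (dvL G K) (Ngr G K p (q - 1)) ⊓ Ngr G K p q

/-- The `E₁`-page of the cohomeology spectral sequence in bidegree `(p,q)`. -/
abbrev E1 (K : SC) (p q : ℤ) :=
  ↥(Z1 G K p q) ⧸ Submodule.comap (Z1 G K p q).subtype (B1 G K p q)

/-- Reduced `E₁`-cocycles. -/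
def Z1R (K : SC) (p q : ℤ) : Submodule ℤ (Pr → G) :=
  NgrR G K p q ⊓ LinearMap.ker (dvRL G K)

/-- Reduced `E₁`-coboundaries. -/
def B1R (K : SC) (p q : ℤ) : Submodule ℤ (Pr → G) :=
  Submodule.map (dvRL G K) (NgrR G K p (q - 1)) ⊓ NgrR G K p q

/-- The `E₁`-page of the reduced cohomeology spectral sequence. -/
abbrev E1R (K : SC) (p q : ℤ) :=
  ↥(Z1R G K p q) ⧸ Submodule.comap (Z1R G K p q).subtype (B1R G K p q)

/-- `E₂`-cocycles: vertical cocycles whose horizontal differential is a vertical coboundary. -/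
def Z2 (K : SC) (p q : ℤ) : Submodule ℤ (Pr → G) :=
  Ngr G K p q ⊓ LinearMap.ker (dvL G K) ⊓
    Submodule.comap (dhL G K) (Submodule.map (dvL G K) (Ngr G K (p - 1) (q - 1)))

/-- `E₂`-coboundaries. -/
def B2 (K : SC) (p q : ℤ) : Submodule ℤ (Pr → G) :=
  (Submodule.map (dvL G K) (Ngr G K p (q - 1)) ⊔
    Submodule.map (dhL G K) (Ngr G K (p + 1) q ⊓ LinearMap.ker (dvL G K))) ⊓ Ngr G K p q

/-- The cohomeology group `𝓗^{p,q}(K; G)`: the `E₂`-page of the cohomeology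
spectral sequence in bidegree `(p,q)`. -/
abbrev HH (K : SC) (p q : ℤ) :=
  ↥(Z2 G K p q) ⧸ Submodule.comap (Z2 G K p q).subtype (B2 G K p q)

/-- Reduced `E₂`-cocycles. -/
def Z2R (K : SC) (p q : ℤ) : Submodule ℤ (Pr → G) :=
  NgrR G K p q ⊓ LinearMap.ker (dvRL G K) ⊓
    Submodule.comap (dhRL G K) (Submodule.map (dvRL G K) (NgrR G K (p - 1) (q - 1)))

/-- Reduced `E₂`-coboundaries. -/
def B2R (K : SC) (p q : ℤ) : Submodule ℤ (Pr → G) :=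
  (Submodule.map (dvRL G K) (NgrR G K p (q - 1)) ⊔
    Submodule.map (dhRL G K) (NgrR G K (p + 1) q ⊓ LinearMap.ker (dvRL G K))) ⊓ NgrR G K p q

/-- The reduced cohomeology group `𝓗̃^{p,q}(K; G)`. -/
abbrev HHR (K : SC) (p q : ℤ) :=
  ↥(Z2R G K p q) ⧸ Submodule.comap (Z2R G K p q).subtype (B2R G K p q)

/-- Total-degree-`n` part of the total complex of `N^{*,*}(K)`. -/
def Tgr (K : SC) (n : ℤ) : Submodule ℤ (Pr → G) :=
  suppM G fun x => x.1 ⊆ x.2 ∧ x.2 ∈ K.faces ∧ x.1 ≠ ∅ ∧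
    (x.2.card : ℤ) - (x.1.card : ℤ) = n

/-- Total-degree-`n` part of the total complex of `Ñ^{*,*}(K)`. -/
def TgrR (K : SC) (n : ℤ) : Submodule ℤ (Pr → G) :=
  suppM G fun x => x.1 ⊆ x.2 ∧ x.2 ∈ K.faces ∧
    (x.2.card : ℤ) - (x.1.card : ℤ) = n

/-- The degree-`n` cohomology of the total complex of `N^{*,*}(K)`. -/
abbrev TotH (K : SC) (n : ℤ) :=
  ↥(Tgr G K n ⊓ LinearMap.ker (dL G K)) ⧸
    Submodule.comap (Tgr G K n ⊓ LinearMap.ker (dL G K)).subtype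
      (Submodule.map (dL G K) (Tgr G K (n - 1)) ⊓ Tgr G K n)

/-- The degree-`n` cohomology of the total complex of `Ñ^{*,*}(K)`. -/
abbrev TotHR (K : SC) (n : ℤ) :=
  ↥(TgrR G K n ⊓ LinearMap.ker (dRL G K)) ⧸
    Submodule.comap (TgrR G K n ⊓ LinearMap.ker (dRL G K)).subtype
      (Submodule.map (dRL G K) (TgrR G K (n - 1)) ⊓ TgrR G K n)

/-- The filtration `F^p` of the total complex by first degree. -/
def Fil (p : ℤ) : Submodule ℤ (Pr → G) :=
  suppM G fun x => (x.1.card : ℤ) ≤ p + 1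

/-- The `E_∞`-term of the cohomeology spectral sequence in bidegree `(p,p)`:
the `p`-th graded piece of the filtration induced on `H^0` of the total complex. -/
abbrev Einf0 (K : SC) (p : ℤ) :=
  ↥(Tgr ℤ K 0 ⊓ LinearMap.ker (dL ℤ K) ⊓ Fil ℤ p) ⧸
    Submodule.comap (Tgr ℤ K 0 ⊓ LinearMap.ker (dL ℤ K) ⊓ Fil ℤ p).subtype
      ((Tgr ℤ K 0 ⊓ LinearMap.ker (dL ℤ K) ⊓ Fil ℤ (p - 1)) ⊔
        (Submodule.map (dL ℤ K) (Tgr ℤ K (-1)) ⊓ Tgr ℤ K 0 ⊓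
          LinearMap.ker (dL ℤ K) ⊓ Fil ℤ p))

end SC
/-- A double complex in the half-plane `p ≥ 0`, with exact augmented rows `A · q → C q` and with
columns that are exact below height `n`. -/
structure AugmentedBicomplex (M M' : Type*) [AddCommGroup M] [AddCommGroup M'] (n : ℤ) where
  A : ℕ → ℤ → Submodule ℤ M
  C : ℤ → Submodule ℤ M'
  dh : M →ₗ[ℤ] M
  dv : M →ₗ[ℤ] M
  ε : M →ₗ[ℤ] M'
  δ : M' →ₗ[ℤ] M'
  dh_dh : ∀ a, dh (dh a) = 0
  dv_dv : ∀ a, dv (dv a) = 0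
  dh_dv : ∀ a, dh (dv a) = -dv (dh a)
  ε_dh : ∀ a, ε (dh a) = 0
  δ_ε : ∀ a, δ (ε a) = -ε (dv a)
  dh_mem : ∀ {k q a}, a ∈ A (k + 1) q → dh a ∈ A k q
  dv_mem : ∀ {k q a}, a ∈ A k q → dv a ∈ A k (q + 1)
  ε_mem : ∀ {q a}, a ∈ A 0 q → ε a ∈ C q
  ε_surj : ∀ {q c}, c ∈ C q → ∃ a ∈ A 0 q, ε a = c
  row_exact_zero : ∀ {q a}, a ∈ A 0 q → ε a = 0 → ∃ b ∈ A 1 q, dh b = a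
  row_exact : ∀ {k q a}, a ∈ A (k + 1) q → dh a = 0 → ∃ b ∈ A (k + 2) q, dh b = a
  col_exact : ∀ {k q a}, a ∈ A k q → q < n → dv a = 0 → ∃ b ∈ A k (q - 1), dv b = a

namespace AugmentedBicomplex

variable {M M' : Type*} [AddCommGroup M] [AddCommGroup M'] {n : ℤ}
  (X : AugmentedBicomplex M M' n)

/-- Pairs `(a, c)` with `a` in bidegree `(k, m + k)` connected by a staircase to the cocycle `c`
of degree `m`. -/
def stair (m : ℤ) : ℕ → Submodule ℤ (M × M')
  | 0 =>
    { carrier := {x | x.1 ∈ X.A 0 m ∧ x.2 ∈ X.C m ∧ X.δ x.2 = 0 ∧ X.ε x.1 = x.2}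
      add_mem' := by
        rintro x y ⟨h1, h2, h3, h4⟩ ⟨g1, g2, g3, g4⟩
        exact ⟨add_mem h1 g1, add_mem h2 g2, by simp [h3, g3], by simp [h4, g4]⟩
      zero_mem' := by simp
      smul_mem' := by
        rintro z x ⟨h1, h2, h3, h4⟩
        exact ⟨Submodule.smul_mem _ z h1, Submodule.smul_mem _ z h2, by simp [h3], by simp [h4]⟩ }
  | k + 1 =>
    { carrier := {x | x.1 ∈ X.A (k + 1) (m + k + 1) ∧
        ∃ a, (a, x.2) ∈ stair m k ∧ X.dh x.1 + X.dv a = 0}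
      add_mem' := by
        rintro x y ⟨h1, a, h2, h3⟩ ⟨g1, b, g2, g3⟩
        refine ⟨add_mem h1 g1, a + b, add_mem h2 g2, ?_⟩
        rw [Prod.fst_add, map_add, map_add, add_add_add_comm, h3, g3, add_zero]
      zero_mem' := ⟨by simp, 0, zero_mem _, by simp⟩
      smul_mem' := by
        rintro z x ⟨h1, a, h2, h3⟩
        refine ⟨Submodule.smul_mem _ z h1, z • a, Submodule.smul_mem _ z h2, ?_⟩
        rw [Prod.smul_fst, map_smul, map_smul, ← smul_add, h3, smul_zero] }

variable {X} {m : ℤ}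

theorem mem_stair_zero {a : M} {c : M'} :
    (a, c) ∈ X.stair m 0 ↔ a ∈ X.A 0 m ∧ c ∈ X.C m ∧ X.δ c = 0 ∧ X.ε a = c := Iff.rfl

theorem mem_stair_succ {k : ℕ} {a : M} {c : M'} :
    (a, c) ∈ X.stair m (k + 1) ↔ a ∈ X.A (k + 1) (m + k + 1) ∧
      ∃ a', (a', c) ∈ X.stair m k ∧ X.dh a + X.dv a' = 0 := Iff.rfl

theorem fst_mem_of_mem_stair {k : ℕ} {a : M} {c : M'} (h : (a, c) ∈ X.stair m k) :
    a ∈ X.A k (m + k) := by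
  cases k with
  | zero => simpa using (mem_stair_zero.1 h).1
  | succ k => simpa [add_assoc] using (mem_stair_succ.1 h).1

theorem snd_mem_of_mem_stair {k : ℕ} {a : M} {c : M'} (h : (a, c) ∈ X.stair m k) :
    c ∈ X.C m ∧ X.δ c = 0 := by
  induction k generalizing a with
  | zero => exact ⟨(mem_stair_zero.1 h).2.1, (mem_stair_zero.1 h).2.2.1⟩
  | succ k ih =>
    obtain ⟨-, a', h', -⟩ := mem_stair_succ.1 h
    exact ih h'

theorem exists_stair_of_dh_add_dv {k : ℕ} {a b : M} (ha : a ∈ X.A k (m + k))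
    (hk : m + k < n) (h : X.dh b + X.dv a = 0) : ∃ c, (a, c) ∈ X.stair m k := by
  have hda : X.dv a = -X.dh b := by rw [eq_neg_iff_add_eq_zero, add_comm, h]
  induction k generalizing a b with
  | zero =>
    simp only [Nat.cast_zero, add_zero] at ha
    exact ⟨_, mem_stair_zero.2 ⟨ha, X.ε_mem ha, by rw [X.δ_ε, hda, map_neg, X.ε_dh]; simp, rfl⟩⟩
  | succ k ih =>
    push_cast at ha hk
    rw [← add_assoc] at ha hk
    have hz : X.dv (X.dh a) = 0 := by
      rw [← neg_eq_zero, ← X.dh_dv, hda, map_neg, X.dh_dh, neg_zero]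
    obtain ⟨e, he, hea⟩ := X.col_exact (X.dh_mem ha) hk hz
    rw [add_sub_cancel_right] at he
    have h' : X.dh a + X.dv (-e) = 0 := by rw [map_neg, hea, add_neg_cancel]
    obtain ⟨c, hc⟩ := ih (neg_mem he) (by omega) h' (by rw [map_neg, hea])
    exact ⟨c, mem_stair_succ.2 ⟨ha, -e, hc, h'⟩⟩

theorem exists_stair_of_cocycle {c : M'} (hc : c ∈ X.C m) (hδ : X.δ c = 0) (k : ℕ) :
    ∃ a, (a, c) ∈ X.stair m k := by
  induction k with
  | zero =>
    obtain ⟨a, ha, rfl⟩ := X.ε_surj hc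
    exact ⟨a, mem_stair_zero.2 ⟨ha, hc, hδ, rfl⟩⟩
  | succ k ih =>
    obtain ⟨a, ha⟩ := ih
    obtain ⟨b, hb, hba⟩ : ∃ b ∈ X.A (k + 1) (m + k + 1), X.dh b = X.dv a := by
      have hm := X.dv_mem (fst_mem_of_mem_stair ha)
      cases k with
      | zero =>
        obtain ⟨-, -, -, rfl⟩ := mem_stair_zero.1 ha
        exact X.row_exact_zero hm (by rw [← neg_eq_zero, ← X.δ_ε, hδ])
      | succ k =>
        obtain ⟨-, a', -, h⟩ := mem_stair_succ.1 ha
        refine X.row_exact hm ?_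
        rw [X.dh_dv, eq_neg_of_add_eq_zero_left h, map_neg, X.dv_dv, neg_zero, neg_zero]
    exact ⟨-b, mem_stair_succ.2 ⟨neg_mem hb, a, ha, by rw [map_neg, hba, neg_add_cancel]⟩⟩

theorem coboundary_of_stair {k : ℕ} {a b b' : M} {c : M'} (h : (a, c) ∈ X.stair m k)
    (hk : m + k ≤ n) (hb : b ∈ X.A k (m + k - 1)) (hb' : b' ∈ X.A (k + 1) (m + k))
    (hab : X.dv b + X.dh b' = a) : ∃ d ∈ X.C (m - 1), X.δ d = c := by
  induction k generalizing a b b' with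
  | zero =>
    obtain ⟨-, -, -, rfl⟩ := mem_stair_zero.1 h
    simp only [Nat.cast_zero, add_zero] at hb
    refine ⟨X.ε (-b), X.ε_mem (neg_mem hb), ?_⟩
    rw [X.δ_ε, ← hab, map_add, X.ε_dh]
    simp
  | succ k ih =>
    obtain ⟨-, a', ha', haa⟩ := mem_stair_succ.1 h
    push_cast at hk hb
    rw [← add_assoc] at hk hb
    rw [add_sub_cancel_right] at hb
    have hz : X.dv (a' - X.dh b) = 0 := by
      rw [← hab, map_add, X.dh_dh, X.dh_dv] at haa
      rw [map_sub, ← haa]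
      abel
    obtain ⟨e, he, hea⟩ := X.col_exact
      (sub_mem (fst_mem_of_mem_stair ha') (X.dh_mem hb)) (by omega) hz
    exact ih ha' (by omega) he hb (by rw [hea, sub_add_cancel])

theorem boundary_of_stair {k : ℕ} {a : M} {c d : M'} (h : (a, c) ∈ X.stair m k)
    (hd : d ∈ X.C (m - 1)) (hdc : X.δ d = c) :
    ∃ b ∈ X.A k (m + k - 1), ∃ b' ∈ X.A (k + 1) (m + k), X.dv b + X.dh b' = a := by
  induction k generalizing a with
  | zero =>
    obtain ⟨ha, -, -, hac⟩ := mem_stair_zero.1 h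
    obtain ⟨b, hb, rfl⟩ := X.ε_surj hd
    have hm : a + X.dv b ∈ X.A 0 m := add_mem ha (by simpa using X.dv_mem hb)
    obtain ⟨b', hb', h'⟩ := X.row_exact_zero hm (by
      rw [map_add, hac, ← hdc, X.δ_ε, neg_add_cancel])
    refine ⟨-b, by simpa using neg_mem hb, b', by simpa using hb', ?_⟩
    rw [h', map_neg]
    abel
  | succ k ih =>
    obtain ⟨ha, a', ha', haa⟩ := mem_stair_succ.1 h
    obtain ⟨b, hb, b', hb', rfl⟩ := ih ha'
    have hz : X.dh (a - X.dv b') = 0 := by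
      rw [map_add, X.dv_dv, zero_add] at haa
      rw [map_sub, X.dh_dv, sub_neg_eq_add, haa]
    obtain ⟨e, he, hea⟩ := X.row_exact (sub_mem ha (X.dv_mem hb')) hz
    refine ⟨b', ?_, e, ?_, ?_⟩
    · simpa [← add_assoc] using hb'
    · simpa [← add_assoc] using he
    · rw [hea, add_sub_cancel]

end AugmentedBicomplex

/-- A linear relation between two subquotients that is total, surjective and compatible with
the denominators induces an isomorphism. -/
theorem nonempty_quotient_equiv_of_relation {M M' : Type*} [AddCommGroup M] [AddCommGroup M']
    {Z B : Submodule ℤ M} {Z' B' : Submodule ℤ M'} (S : Submodule ℤ (M × M'))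
    (hS : ∀ x ∈ S, x.1 ∈ Z ∧ x.2 ∈ Z' ∧ (x.1 ∈ B ↔ x.2 ∈ B'))
    (hZ : ∀ a ∈ Z, ∃ c, (a, c) ∈ S) (hZ' : ∀ c ∈ Z', ∃ a, (a, c) ∈ S) :
    Nonempty ((↥Z ⧸ Submodule.comap Z.subtype B) ≃+ (↥Z' ⧸ Submodule.comap Z'.subtype B')) := by
  let f : S →ₗ[ℤ] ↥Z ⧸ Submodule.comap Z.subtype B :=
    (Submodule.mkQ _).comp (((LinearMap.fst ℤ M M').comp S.subtype).codRestrict Z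
      fun x => (hS x x.2).1)
  let g : S →ₗ[ℤ] ↥Z' ⧸ Submodule.comap Z'.subtype B' :=
    (Submodule.mkQ _).comp (((LinearMap.snd ℤ M M').comp S.subtype).codRestrict Z'
      fun x => (hS x x.2).2.1)
  have hf : Function.Surjective f := by
    intro y
    obtain ⟨⟨a, ha⟩, rfl⟩ := Submodule.mkQ_surjective _ y
    obtain ⟨c, hc⟩ := hZ a ha
    exact ⟨⟨_, hc⟩, rfl⟩
  have hg : Function.Surjective g := by
    intro y
    obtain ⟨⟨c, hc⟩, rfl⟩ := Submodule.mkQ_surjective _ y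
    obtain ⟨a, ha⟩ := hZ' c hc
    exact ⟨⟨_, ha⟩, rfl⟩
  have hker : LinearMap.ker f = LinearMap.ker g := by
    ext x
    simp only [f, g, LinearMap.mem_ker, LinearMap.comp_apply, Submodule.mkQ_apply,
      Submodule.Quotient.mk_eq_zero, Submodule.mem_comap]
    exact (hS x x.2).2.2
  exact ⟨((f.quotKerEquivOfSurjective hf).symm.trans
    ((Submodule.quotEquivOfEq _ _ hker).trans (g.quotKerEquivOfSurjective hg))).toAddEquiv⟩

namespace SC

variable {G : Type} [AddCommGroup G] {K : SC}

theorem sum_sum_erase_eq_zero {α : Type*} [DecidableEq α] (s : Finset α) (f : α → α → G)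
    (h : ∀ u ∈ s, ∀ v ∈ s, u ≠ v → f u v + f v u = 0) :
    ∑ u ∈ s, ∑ v ∈ s.erase u, f u v = 0 := by
  rw [Finset.sum_sigma']
  refine Finset.sum_involution (fun x _ => ⟨x.2, x.1⟩) ?_ ?_ ?_ ?_
  · rintro ⟨u, v⟩ hx
    simp only [mem_sigma, mem_erase] at hx
    exact h u hx.1 v hx.2.2 (Ne.symm hx.2.1)
  · rintro ⟨u, v⟩ hx - heq
    simp only [mem_sigma, mem_erase] at hx
    exact hx.2.1 (congrArg Sigma.fst heq)
  · rintro ⟨u, v⟩ hx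
    simp only [mem_sigma, mem_erase] at hx ⊢
    exact ⟨hx.2.2, Ne.symm hx.2.1, hx.1⟩
  · rintro ⟨u, v⟩ -
    rfl

theorem psgn_eq_prod (v : ℕ) (s : Finset ℕ) :
    psgn v s = ∏ u ∈ s, if u < v then (-1 : ℤ) else 1 := by
  rw [psgn, Finset.prod_ite, Finset.prod_const, Finset.prod_const_one, mul_one]

theorem psgn_mul_self (v : ℕ) (s : Finset ℕ) : psgn v s * psgn v s = 1 := by
  rw [psgn, ← mul_pow]
  norm_num

theorem psgn_insert_self (v : ℕ) (s : Finset ℕ) : psgn v (insert v s) = psgn v s := by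
  rw [psgn, psgn, Finset.filter_insert, if_neg (lt_irrefl v)]

theorem psgn_insert {u v : ℕ} {s : Finset ℕ} (hv : v ∉ s) :
    psgn u (insert v s) = (if v < u then -1 else 1) * psgn u s := by
  rw [psgn_eq_prod, Finset.prod_insert hv, ← psgn_eq_prod]

theorem psgn_erase {u w : ℕ} {s : Finset ℕ} (hw : w ∈ s) :
    psgn u s = (if w < u then -1 else 1) * psgn u (s.erase w) := by
  rw [← psgn_insert (notMem_erase w s), insert_erase hw]

theorem psgn_union (w : ℕ) {s t : Finset ℕ} (h : Disjoint s t) :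
    psgn w (s ∪ t) = psgn w s * psgn w t := by
  simp only [psgn_eq_prod, Finset.prod_union h]

/-- The horizontal differential `σ ⊗ τ ↦ dσ ⊗ τ` without restrictions on `σ` and `τ`. -/
def hsum (c : Pr → G) (σ τ : Finset ℕ) : G :=
  ∑ v ∈ τ \ σ, psgn v (insert v σ) • c (insert v σ, τ)

/-- The vertical differential `σ ⊗ τ ↦ σ ⊗ δτ`, without sign or restrictions on `τ`. -/
def vsum (c : Pr → G) (σ τ : Finset ℕ) : G :=
  ∑ w ∈ τ \ σ, psgn w τ • c (σ, τ.erase w)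

theorem hsum_congr {c c' : Pr → G} {σ τ : Finset ℕ}
    (h : ∀ v ∈ τ \ σ, c (insert v σ, τ) = c' (insert v σ, τ)) : hsum c σ τ = hsum c' σ τ :=
  Finset.sum_congr rfl fun v hv => by rw [h v hv]

theorem vsum_congr {c c' : Pr → G} {σ τ : Finset ℕ}
    (h : ∀ w ∈ τ \ σ, c (σ, τ.erase w) = c' (σ, τ.erase w)) : vsum c σ τ = vsum c' σ τ :=
  Finset.sum_congr rfl fun v hv => by rw [h v hv]

theorem hsum_hsum (c : Pr → G) (σ τ : Finset ℕ) :
    hsum (fun x => hsum c x.1 x.2) σ τ = 0 := by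
  have key := sum_sum_erase_eq_zero (τ \ σ) (fun v u =>
    (psgn v (insert v σ) * psgn u (insert u (insert v σ))) • c (insert u (insert v σ), τ)) (by
      intro v hv u hu huv
      simp only [mem_sdiff] at hv hu
      rw [show c (insert v (insert u σ), τ) = c (insert u (insert v σ), τ) by
        rw [Finset.insert_comm], ← add_smul]
      simp only [psgn_insert_self]
      rw [psgn_insert hv.2, psgn_insert hu.2]
      rcases lt_or_gt_of_ne huv with h | h
      · simp [h, h.not_gt, mul_comm]
      · simp [h, h.not_gt, mul_comm])
  rw [← key]
  refine Finset.sum_congr rfl fun v _ => ?_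
  simp only [hsum]
  rw [Finset.smul_sum, Finset.sdiff_insert]
  exact Finset.sum_congr rfl fun u _ => by rw [smul_smul]

theorem vsum_vsum (c : Pr → G) (σ τ : Finset ℕ) :
    vsum (fun x => vsum c x.1 x.2) σ τ = 0 := by
  have key := sum_sum_erase_eq_zero (τ \ σ) (fun w u =>
    (psgn w τ * psgn u (τ.erase w)) • c (σ, (τ.erase w).erase u)) (by
      intro w hw u hu huw
      simp only [mem_sdiff] at hw hu
      rw [Finset.erase_right_comm, ← add_smul, psgn_erase (u := w) hu.1,
        psgn_erase (u := u) hw.1]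
      rcases lt_or_gt_of_ne huw with h | h
      · simp [h, h.not_gt, mul_comm]
      · simp [h, h.not_gt, mul_comm])
  rw [← key]
  refine Finset.sum_congr rfl fun v _ => ?_
  simp only [vsum]
  rw [Finset.smul_sum, Finset.erase_sdiff_comm]
  exact Finset.sum_congr rfl fun u _ => by rw [smul_smul]

theorem hsum_vsum (c : Pr → G) (σ τ : Finset ℕ) :
    hsum (fun x => vsum c x.1 x.2) σ τ = vsum (fun x => hsum c x.1 x.2) σ τ := by
  simp only [hsum, vsum, Finset.smul_sum]
  rw [Finset.sum_comm' (t' := τ \ σ) (s' := fun w => τ.erase w \ σ)]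
  · exact Finset.sum_congr rfl fun w _ => Finset.sum_congr rfl fun v _ => smul_comm _ _ _
  · intro v w
    simp only [mem_sdiff, mem_insert, mem_erase, not_or]
    tauto

theorem hsum_smul (z : ℤ) (c : Pr → G) (σ τ : Finset ℕ) :
    hsum (fun x => z • c x) σ τ = z • hsum c σ τ := by
  simp only [hsum, Finset.smul_sum]
  exact Finset.sum_congr rfl fun _ _ => smul_comm _ _ _

theorem vsum_smul (z : ℤ) (c : Pr → G) (σ τ : Finset ℕ) :
    vsum (fun x => z • c x) σ τ = z • vsum c σ τ := by
  simp only [vsum, Finset.smul_sum]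
  exact Finset.sum_congr rfl fun _ _ => smul_comm _ _ _

theorem dhL_apply (c : Pr → G) (x : Pr) :
    dhL G K c x = if x.2 ∈ K.faces ∧ x.1 ⊆ x.2 ∧ x.1 ≠ ∅ then hsum c x.1 x.2 else 0 := rfl

theorem dvL_apply (c : Pr → G) (x : Pr) :
    dvL G K c x = if x.2 ∈ K.faces ∧ x.1 ⊆ x.2 ∧ x.1 ≠ ∅ then
      ((-1 : ℤ) ^ x.1.card) • vsum c x.1 x.2 else 0 := by
  change dvF G K c x = _
  rw [dvF]
  refine if_ctx_congr Iff.rfl (fun h => ?_) fun _ => rfl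
  rw [vsum, ← Finset.sum_filter]
  congr 1
  refine Finset.sum_congr (Finset.ext fun w => ?_) fun _ _ => rfl
  simp only [mem_filter, mem_sdiff, Finset.subset_erase, h.2.1, true_and]

variable (G K) in
/-- The augmentation of the row complexes onto the simplicial cochains. -/
def augL : (Pr → G) →ₗ[ℤ] (Finset ℕ → G) where
  toFun c τ := if τ ∈ K.faces then hsum c ∅ τ else 0
  map_add' a b := by
    funext τ
    simp only [Pi.add_apply]
    split_ifs with h
    · simp only [hsum, Pi.add_apply, smul_add, Finset.sum_add_distrib]
    · simp
  map_smul' z a := by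
    funext τ
    simp only [Pi.smul_apply, RingHom.id_apply]
    split_ifs with h
    · exact hsum_smul z a ∅ τ
    · simp

theorem augL_apply (c : Pr → G) (τ : Finset ℕ) :
    augL G K c τ = if τ ∈ K.faces then hsum c ∅ τ else 0 := rfl

theorem insert_good {σ τ : Finset ℕ} {v : ℕ} (hτ : τ ∈ K.faces) (h : σ ⊆ τ) (hv : v ∈ τ \ σ) :
    τ ∈ K.faces ∧ insert v σ ⊆ τ ∧ insert v σ ≠ ∅ :=
  ⟨hτ, insert_subset (mem_sdiff.1 hv).1 h, insert_ne_empty _ _⟩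

theorem erase_good {σ τ : Finset ℕ} {w : ℕ} (hτ : τ ∈ K.faces) (h : σ ⊆ τ) (hw : w ∈ τ \ σ) :
    τ.erase w ∈ K.faces ∧ σ ⊆ τ.erase w :=
  ⟨K.down_closed hτ (erase_subset _ _), subset_erase.2 ⟨h, (mem_sdiff.1 hw).2⟩⟩

theorem hsum_dhL (c : Pr → G) {σ τ : Finset ℕ} (hτ : τ ∈ K.faces) (h : σ ⊆ τ) :
    hsum (dhL G K c) σ τ = 0 := by
  rw [← hsum_hsum c σ τ]
  exact hsum_congr fun v hv => by rw [dhL_apply, if_pos (insert_good hτ h hv)]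

theorem hsum_dvL (c : Pr → G) {σ τ : Finset ℕ} (hτ : τ ∈ K.faces) (h : σ ⊆ τ) :
    hsum (dvL G K c) σ τ =
      -((-1 : ℤ) ^ σ.card • vsum (fun x => hsum c x.1 x.2) σ τ) := by
  rw [← hsum_vsum, ← hsum_smul, ← neg_one_smul ℤ, ← hsum_smul]
  refine hsum_congr fun v hv => ?_
  rw [dvL_apply, if_pos (insert_good hτ h hv)]
  dsimp only
  rw [card_insert_of_notMem (mem_sdiff.1 hv).2, smul_smul, pow_succ']

theorem dhL_dhL (c : Pr → G) : dhL G K (dhL G K c) = 0 := by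
  funext x
  rw [dhL_apply]
  split_ifs with h
  · exact hsum_dhL c h.1 h.2.1
  · rfl

theorem dvL_dvL (c : Pr → G) : dvL G K (dvL G K c) = 0 := by
  funext x
  rw [dvL_apply]
  split_ifs with h
  · have h1 : vsum (dvL G K c) x.1 x.2 =
        vsum (fun y => (-1 : ℤ) ^ x.1.card • vsum c y.1 y.2) x.1 x.2 := by
      refine vsum_congr fun w hw => ?_
      have := erase_good h.1 h.2.1 hw
      rw [dvL_apply, if_pos ⟨this.1, this.2, h.2.2⟩]
    rw [h1, vsum_smul, vsum_vsum, smul_zero, smul_zero]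
    rfl
  · rfl

theorem dhL_dvL (c : Pr → G) : dhL G K (dvL G K c) = -dvL G K (dhL G K c) := by
  funext x
  rw [Pi.neg_apply, dhL_apply, dvL_apply]
  split_ifs with h
  · rw [hsum_dvL c h.1 h.2.1]
    congr 2
    refine vsum_congr fun w hw => ?_
    have := erase_good h.1 h.2.1 hw
    rw [dhL_apply, if_pos ⟨this.1, this.2, h.2.2⟩]
  · simp

theorem augL_dhL (c : Pr → G) : augL G K (dhL G K c) = 0 := by
  funext τ
  rw [augL_apply]
  split_ifs with h
  · exact hsum_dhL c h (empty_subset _)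
  · rfl

theorem cobL_augL (c : Pr → G) : cobL G K (augL G K c) = -augL G K (dvL G K c) := by
  funext τ
  rw [Pi.neg_apply, augL_apply]
  change cobF G K _ τ = _
  rw [cobF]
  split_ifs with h
  · rw [hsum_dvL c h (empty_subset _), card_empty, pow_zero, one_smul, neg_neg, vsum, sdiff_empty]
    refine Finset.sum_congr rfl fun w hw => ?_
    rw [augL_apply, if_pos (K.down_closed h (erase_subset _ _))]
    split_ifs with h0
    · simp [h0, hsum]
    · rfl
  · simp

theorem dhL_mem {k : ℕ} {q : ℤ} {c : Pr → G} (hc : c ∈ Ngr G K ((k + 1 : ℕ) : ℤ) q) :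
    dhL G K c ∈ Ngr G K k q := by
  intro x hx
  rw [dhL_apply] at hx
  split_ifs at hx with h
  · obtain ⟨v, hv, hne⟩ := Finset.exists_ne_zero_of_sum_ne_zero hx
    obtain ⟨-, -, -, h1, h2⟩ := hc _ (right_ne_zero_of_smul hne)
    rw [card_insert_of_notMem (mem_sdiff.1 hv).2] at h1
    push_cast at h1
    exact ⟨h.2.1, h.1, h.2.2, by omega, h2⟩
  · exact absurd rfl hx

theorem dhL_eq_zero {q : ℤ} {c : Pr → G} (hc : c ∈ Ngr G K 0 q) : dhL G K c = 0 := by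
  funext x
  by_contra hx
  change dhL G K c x ≠ 0 at hx
  rw [dhL_apply] at hx
  split_ifs at hx with h
  · obtain ⟨v, hv, hne⟩ := Finset.exists_ne_zero_of_sum_ne_zero hx
    obtain ⟨-, -, -, h1, -⟩ := hc _ (right_ne_zero_of_smul hne)
    rw [card_insert_of_notMem (mem_sdiff.1 hv).2] at h1
    have := card_pos.2 (nonempty_iff_ne_empty.2 h.2.2)
    push_cast at h1
    omega
  · exact absurd rfl hx

theorem dvL_mem {p q : ℤ} {c : Pr → G} (hc : c ∈ Ngr G K p q) :
    dvL G K c ∈ Ngr G K p (q + 1) := by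
  intro x hx
  rw [dvL_apply] at hx
  split_ifs at hx with h
  · obtain ⟨w, hw, hne⟩ := Finset.exists_ne_zero_of_sum_ne_zero (right_ne_zero_of_smul hx)
    obtain ⟨-, -, -, h1, h2⟩ := hc _ (right_ne_zero_of_smul hne)
    have := card_erase_add_one (mem_sdiff.1 hw).1
    exact ⟨h.2.1, h.1, h.2.2, h1, by dsimp only at h2; omega⟩
  · exact absurd rfl hx

theorem augL_mem {q : ℤ} {c : Pr → G} (hc : c ∈ Ngr G K 0 q) : augL G K c ∈ Cgr G K q := by
  intro τ hx
  rw [augL_apply] at hx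
  split_ifs at hx with h
  · obtain ⟨v, hv, hne⟩ := Finset.exists_ne_zero_of_sum_ne_zero hx
    obtain ⟨-, -, -, -, h2⟩ := hc _ (right_ne_zero_of_smul hne)
    exact ⟨h, ne_empty_of_mem (mem_sdiff.1 hv).1, h2⟩
  · exact absurd rfl hx

theorem sInf_coe_mem {τ : Finset ℕ} (h : τ ≠ ∅) : sInf (τ : Set ℕ) ∈ τ :=
  Nat.sInf_mem (coe_nonempty.2 (nonempty_iff_ne_empty.2 h))

theorem augL_surj {q : ℤ} {c : Finset ℕ → G} (hc : c ∈ Cgr G K q) :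
    ∃ a ∈ Ngr G K 0 q, augL G K a = c := by
  refine ⟨fun x => if x.1 = {sInf (x.2 : Set ℕ)} then c x.2 else 0, ?_, ?_⟩
  · rintro ⟨σ, τ⟩ hx
    dsimp only at hx ⊢
    split_ifs at hx with h
    · obtain ⟨h1, h2, h3⟩ := hc _ hx
      subst h
      exact ⟨singleton_subset_iff.2 (sInf_coe_mem h2), h1, singleton_ne_empty _, by simp, h3⟩
    · exact absurd rfl hx
  · funext τ
    rw [augL_apply]
    by_cases h0 : c τ = 0
    · rw [h0]
      split_ifs
      · exact Finset.sum_eq_zero fun v _ => by simp [h0]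
      · rfl
    · obtain ⟨h1, h2, -⟩ := hc _ h0
      rw [if_pos h1, hsum, Finset.sum_eq_single_of_mem (sInf (τ : Set ℕ))]
      · simp [psgn, filter_singleton]
      · simpa using sInf_coe_mem h2
      · intro v _ hv
        simp [hv]

/-- The cone contraction of the augmented simplicial chain complex of the simplex `τ` onto its
vertex `v`. -/
theorem hsum_cone {c b : Pr → G} {τ : Finset ℕ} {v : ℕ} (hv : v ∈ τ)
    (hb : ∀ σ, b (σ, τ) = if v ∈ σ then psgn v σ • c (σ.erase v, τ) else 0)
    (hc : ∀ σ ⊆ τ, hsum c σ τ = 0) {σ : Finset ℕ} (hσ : σ ⊆ τ) : hsum b σ τ = c (σ, τ) := by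
  by_cases hvσ : v ∈ σ
  · have h0 := hc (σ.erase v) ((erase_subset _ _).trans hσ)
    have hs : τ \ σ.erase v = insert v (τ \ σ) := by
      ext u
      simp only [mem_sdiff, mem_erase, mem_insert]
      by_cases huv : u = v
      · simp [huv, hv]
      · simp [huv]
    rw [hsum, hs, Finset.sum_insert (by simp [hvσ]), insert_erase hvσ] at h0
    have h1 : hsum b σ τ = -(psgn v σ • ∑ u ∈ τ \ σ,
        psgn u (insert u (σ.erase v)) • c (insert u (σ.erase v), τ)) := by
      rw [hsum, Finset.smul_sum, ← Finset.sum_neg_distrib]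
      refine Finset.sum_congr rfl fun u hu => ?_
      have huσ := (mem_sdiff.1 hu).2
      have huv : u ≠ v := fun h => huσ (h ▸ hvσ)
      rw [hb, if_pos (mem_insert_of_mem hvσ), erase_insert_of_ne huv, smul_smul, smul_smul,
        ← neg_smul, psgn_insert_self, psgn_insert_self, psgn_insert huσ, psgn_erase (u := u) hvσ]
      congr 1
      rcases lt_or_gt_of_ne huv with h | h
      · simp [h, h.not_gt, mul_comm]
      · simp [h, h.not_gt, mul_comm]
    rw [h1, eq_neg_of_add_eq_zero_right h0, smul_neg, neg_neg, smul_smul, psgn_mul_self, one_smul]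
  · rw [hsum, Finset.sum_eq_single_of_mem v (mem_sdiff.2 ⟨hv, hvσ⟩)]
    · rw [hb, if_pos (mem_insert_self _ _), smul_smul, psgn_mul_self, one_smul, erase_insert hvσ]
    · intro u _ huv
      rw [hb, if_neg (by simp [Ne.symm huv, hvσ]), smul_zero]

theorem exists_dhL_eq {k : ℕ} {q : ℤ} {c : Pr → G} (hc : c ∈ Ngr G K k q)
    (h : ∀ σ τ, τ ∈ K.faces → σ ⊆ τ → hsum c σ τ = 0) :
    ∃ b ∈ Ngr G K ((k + 1 : ℕ) : ℤ) q, dhL G K b = c := by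
  let b : Pr → G := fun x => if sInf (x.2 : Set ℕ) ∈ x.1 then
    psgn (sInf (x.2 : Set ℕ)) x.1 • c (x.1.erase (sInf (x.2 : Set ℕ)), x.2) else 0
  refine ⟨b, ?_, ?_⟩
  · rintro ⟨σ, τ⟩ hx
    dsimp only [b] at hx ⊢
    split_ifs at hx with h1
    · obtain ⟨g1, g2, g3, g4, g5⟩ := hc _ (right_ne_zero_of_smul hx)
      have hτ : τ ≠ ∅ := fun h => g3 (subset_empty.1 (h ▸ g1))
      have hcard := card_erase_add_one h1
      dsimp only at g1 g4
      refine ⟨?_, g2, ne_empty_of_mem h1, ?_, g5⟩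
      · rw [← insert_erase h1]
        exact insert_subset (sInf_coe_mem hτ) g1
      · push_cast
        omega
    · exact absurd rfl hx
  · funext ⟨σ, τ⟩
    rw [dhL_apply]
    split_ifs with hg
    · obtain ⟨g1, g2, g3⟩ := hg
      have hτ : τ ≠ ∅ := fun h => g3 (subset_empty.1 (h ▸ g2))
      exact hsum_cone (sInf_coe_mem hτ) (fun _ => rfl) (fun σ' h' => h σ' τ g1 h') g2
    · by_contra hne
      obtain ⟨g1, g2, g3, -⟩ := hc _ (Ne.symm hne)
      exact hg ⟨g2, g1, g3⟩

theorem row_exact_zero {q : ℤ} {c : Pr → G} (hc : c ∈ Ngr G K (0 : ℕ) q)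
    (h : augL G K c = 0) : ∃ b ∈ Ngr G K (1 : ℕ) q, dhL G K b = c := by
  refine exists_dhL_eq hc fun σ τ hτ hσ => ?_
  by_cases h0 : σ = ∅
  · have := congrFun h τ
    rw [augL_apply, if_pos hτ] at this
    rw [h0, this]
    rfl
  · have := congrFun (dhL_eq_zero hc) (σ, τ)
    rw [dhL_apply, if_pos ⟨hτ, hσ, h0⟩] at this
    exact this

theorem row_exact {k : ℕ} {q : ℤ} {c : Pr → G} (hc : c ∈ Ngr G K ((k + 1 : ℕ) : ℤ) q)
    (h : dhL G K c = 0) : ∃ b ∈ Ngr G K ((k + 2 : ℕ) : ℤ) q, dhL G K b = c := by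
  refine exists_dhL_eq hc fun σ τ hτ hσ => ?_
  by_cases h0 : σ = ∅
  · refine Finset.sum_eq_zero fun v _ => ?_
    by_contra hne
    obtain ⟨-, -, -, h1, -⟩ := hc _ (right_ne_zero_of_smul hne)
    simp only [h0, insert_empty_eq, card_singleton] at h1
    push_cast at h1
    omega
  · have := congrFun h (σ, τ)
    rw [dhL_apply, if_pos ⟨hτ, hσ, h0⟩] at this
    exact this

/-- The sign comparing the cochains of the link of `σ` with the column of `σ`. -/
def linkSign (σ t : Finset ℕ) : ℤ := ∏ u ∈ t, psgn u σ

theorem linkSign_mul_self (σ t : Finset ℕ) : linkSign σ t * linkSign σ t = 1 := by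
  rw [linkSign, ← Finset.prod_mul_distrib]
  exact Finset.prod_eq_one fun u _ => psgn_mul_self u σ

theorem psgn_mul_linkSign_erase {σ t : Finset ℕ} {w : ℕ} (h : Disjoint σ t) (hw : w ∈ t) :
    psgn w (σ ∪ t) * linkSign σ (t.erase w) = linkSign σ t * psgn w t := by
  rw [psgn_union w h, linkSign, linkSign, ← Finset.mul_prod_erase t _ hw]
  ring

theorem cobRL_apply (c : Finset ℕ → G) (ρ : Finset ℕ) : cobRL G K c ρ =
    if ρ ∈ K.faces then ∑ w ∈ ρ, psgn w ρ • c (ρ.erase w) else 0 := rfl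

theorem mem_link {σ t : Finset ℕ} :
    t ∈ (K.link σ).faces ↔ t ∈ K.faces ∧ σ ∪ t ∈ K.faces ∧ Disjoint σ t := by
  simp [link]

/-- A column of the double complex is, up to sign, the reduced cochain complex of a link. -/
theorem vsum_eq_linkSign_smul {c : Pr → G} {b : Finset ℕ → G} {σ t : Finset ℕ}
    (hd : Disjoint σ t) (hcb : ∀ t' ⊆ t, c (σ, σ ∪ t') = linkSign σ t' • b t') :
    vsum c σ (σ ∪ t) = linkSign σ t • ∑ w ∈ t, psgn w t • b (t.erase w) := by
  rw [vsum, union_sdiff_cancel_left hd, Finset.smul_sum]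
  refine Finset.sum_congr rfl fun w hw => ?_
  have he : (σ ∪ t).erase w = σ ∪ t.erase w := by
    rw [erase_union_distrib, erase_eq_of_notMem fun h => (disjoint_left.1 hd) h hw]
  rw [he, hcb _ (erase_subset _ _), smul_smul, smul_smul, psgn_mul_linkSign_erase hd hw]

theorem exists_link_primitive {p q : ℤ} {c : Pr → G} (hc : c ∈ Ngr G K p q)
    (h : dvL G K c = 0) {σ : Finset ℕ} (h0 : σ ≠ ∅)
    (hlink : Subsingleton (cohR G (K.link σ) (q - σ.card))) :
    ∃ b ∈ CgrR G (K.link σ) (q - σ.card - 1), ∀ t ∈ (K.link σ).faces,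
      ∑ w ∈ t, psgn w t • b (t.erase w) = linkSign σ t • c (σ, σ ∪ t) := by
  let a : Finset ℕ → G := fun t => if Disjoint σ t then linkSign σ t • c (σ, σ ∪ t) else 0
  have hca : ∀ t, Disjoint σ t → c (σ, σ ∪ t) = linkSign σ t • a t := by
    intro t ht
    dsimp only [a]
    rw [if_pos ht, smul_smul, linkSign_mul_self, one_smul]
  have hm : a ∈ CgrR G (K.link σ) (q - σ.card) := by
    intro t ht
    dsimp only [a] at ht
    split_ifs at ht with hd
    · obtain ⟨-, g1, -, -, g2⟩ := hc _ (right_ne_zero_of_smul ht)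
      dsimp only at g1 g2
      rw [card_union_of_disjoint hd] at g2
      push_cast at g2
      exact ⟨mem_link.2 ⟨K.down_closed g1 subset_union_right, g1, hd⟩, by omega⟩
    · exact absurd rfl ht
  have hk : a ∈ LinearMap.ker (cobRL G (K.link σ)) := by
    rw [LinearMap.mem_ker]
    funext t
    rw [cobRL_apply]
    split_ifs with ht
    · obtain ⟨-, hf, hd⟩ := mem_link.1 ht
      have hv := congrFun h (σ, σ ∪ t)
      rw [dvL_apply, if_pos ⟨hf, subset_union_left, h0⟩, vsum_eq_linkSign_smul hd
        fun t' ht' => hca t' (hd.mono_right ht')] at hv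
      have hv' := congrArg (fun y : G => (linkSign σ t * (-1 : ℤ) ^ σ.card) • y) hv
      simp only [smul_smul, Pi.zero_apply, smul_zero] at hv'
      rwa [show linkSign σ t * (-1) ^ σ.card * ((-1) ^ σ.card * linkSign σ t) = 1 by
        have hl := linkSign_mul_self σ t
        have : ((-1 : ℤ) ^ σ.card) * (-1) ^ σ.card = 1 := by rw [← mul_pow]; norm_num
        linear_combination linkSign σ t * linkSign σ t * this + hl, one_smul] at hv'
    · rfl
  obtain ⟨b, hb, hba⟩ := Submodule.mem_comap.1 ((Submodule.Quotient.mk_eq_zero _).1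
    (Subsingleton.elim (Submodule.Quotient.mk ⟨a, hm, hk⟩ : cohR G (K.link σ) (q - σ.card)) 0))
  refine ⟨b, hb, fun t ht => ?_⟩
  have := congrFun hba t
  rw [cobRL_apply, if_pos ht] at this
  rw [this]
  exact if_pos (mem_link.1 ht).2.2

theorem col_exact {p q : ℤ} {c : Pr → G} (hc : c ∈ Ngr G K p q) (h : dvL G K c = 0)
    (hlink : ∀ σ ∈ K.faces, σ ≠ ∅ → Subsingleton (cohR G (K.link σ) (q - σ.card))) :
    ∃ b ∈ Ngr G K p (q - 1), dvL G K b = c := by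
  have hex : ∀ σ : Finset ℕ, ∃ b : Finset ℕ → G, σ ∈ K.faces → σ ≠ ∅ → (σ.card : ℤ) = p + 1 →
      b ∈ CgrR G (K.link σ) (q - σ.card - 1) ∧ ∀ t ∈ (K.link σ).faces,
        ∑ w ∈ t, psgn w t • b (t.erase w) = linkSign σ t • c (σ, σ ∪ t) := by
    intro σ
    by_cases hσ : σ ∈ K.faces ∧ σ ≠ ∅
    · obtain ⟨b, hb⟩ := exists_link_primitive hc h hσ.2 (hlink σ hσ.1 hσ.2)
      exact ⟨b, fun _ _ _ => hb⟩
    · exact ⟨0, fun h1 h2 => absurd ⟨h1, h2⟩ hσ⟩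
  choose b hb using hex
  let e : Pr → G := fun x =>
    if x.1 ⊆ x.2 ∧ x.1 ∈ K.faces ∧ x.1 ≠ ∅ ∧ (x.1.card : ℤ) = p + 1 then
      linkSign x.1 (x.2 \ x.1) • ((-1 : ℤ) ^ x.1.card • b x.1 (x.2 \ x.1)) else 0
  refine ⟨e, ?_, ?_⟩
  · rintro ⟨σ, τ⟩ hx
    dsimp only [e] at hx ⊢
    split_ifs at hx with hg
    · obtain ⟨g1, g2, g3, g4⟩ := hg
      obtain ⟨k1, k2⟩ := (hb σ g2 g3 g4).1 _ (right_ne_zero_of_smul (right_ne_zero_of_smul hx))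
      have k3 := (mem_link.1 k1).2.1
      rw [union_sdiff_of_subset g1] at k3
      have := card_sdiff_add_card_eq_card g1
      exact ⟨g1, k3, g3, g4, by omega⟩
    · exact absurd rfl hx
  · funext ⟨σ, τ⟩
    rw [dvL_apply]
    split_ifs with hg
    · obtain ⟨g1, g2, g3⟩ := hg
      dsimp only at g1 g2 g3 ⊢
      have hσ := K.down_closed g1 g2
      obtain ⟨t, hd, rfl⟩ : ∃ t, Disjoint σ t ∧ σ ∪ t = τ :=
        ⟨τ \ σ, disjoint_sdiff, union_sdiff_of_subset g2⟩
      by_cases g4 : (σ.card : ℤ) = p + 1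
      · rw [vsum_eq_linkSign_smul (b := fun t => (-1 : ℤ) ^ σ.card • b σ t) hd]
        · have hl := (hb σ hσ g3 g4).2 t
            (mem_link.2 ⟨K.down_closed g1 subset_union_right, g1, hd⟩)
          simp only [smul_comm (psgn _ t) ((-1 : ℤ) ^ σ.card)]
          rw [← Finset.smul_sum, hl, smul_comm (linkSign σ t), smul_smul, smul_smul, smul_smul,
            ← mul_pow, neg_one_mul, neg_neg, one_pow, one_mul, linkSign_mul_self, one_smul]
        · intro t' ht'
          dsimp only [e]
          rw [if_pos ⟨subset_union_left, hσ, g3, g4⟩,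
            union_sdiff_cancel_left (hd.mono_right ht')]
      · have hz : c (σ, σ ∪ t) = 0 := by
          by_contra hne
          exact g4 (hc _ hne).2.2.2.1
        rw [hz, vsum, Finset.sum_eq_zero, smul_zero]
        intro w _
        dsimp only [e]
        rw [if_neg fun h => g4 h.2.2.2, smul_zero]
    · by_contra hne
      obtain ⟨g1, g2, g3, -⟩ := hc _ (Ne.symm hne)
      exact hg ⟨g2, g1, g3⟩

theorem card_le_of_dim {n : ℤ} (hn : K.dim = n) {τ : Finset ℕ} (h : τ ∈ K.faces) :
    (τ.card : ℤ) ≤ n + 1 := by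
  have := Finset.le_sup (f := Finset.card) h
  rw [dim] at hn
  omega

theorem Ngr_eq_zero {n p q : ℤ} (hn : K.dim = n) {c : Pr → G} (hc : c ∈ Ngr G K p q)
    (h : p < 0 ∨ n < q) : c = 0 := by
  funext x
  by_contra hx
  obtain ⟨-, h1, h2, h3, h4⟩ := hc x hx
  have := card_le_of_dim hn h1
  have := card_pos.2 (nonempty_iff_ne_empty.2 h2)
  omega

theorem Cgr_eq_zero {n q : ℤ} (hn : K.dim = n) {c : Finset ℕ → G} (hc : c ∈ Cgr G K q)
    (h : n < q) : c = 0 := by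
  funext x
  by_contra hx
  obtain ⟨h1, -, h3⟩ := hc x hx
  have := card_le_of_dim hn h1
  omega

variable (G K) in
/-- The double complex `N^{*,*}(K; G)` with its augmentation onto the simplicial cochains. -/
def bicomplex {n : ℤ}
    (hlink : ∀ σ ∈ K.faces, σ ≠ ∅ → ∀ i : ℤ, i ≠ n - (σ.card : ℤ) →
      Subsingleton (cohR G (K.link σ) i)) :
    AugmentedBicomplex (Pr → G) (Finset ℕ → G) n where
  A k q := Ngr G K k q
  C q := Cgr G K q
  dh := dhL G K
  dv := dvL G K
  ε := augL G K
  δ := cobL G K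
  dh_dh := dhL_dhL
  dv_dv := dvL_dvL
  dh_dv := dhL_dvL
  ε_dh := augL_dhL
  δ_ε := cobL_augL
  dh_mem := dhL_mem
  dv_mem := dvL_mem
  ε_mem := augL_mem
  ε_surj := augL_surj
  row_exact_zero := row_exact_zero
  row_exact := row_exact
  col_exact hc hq h := col_exact hc h fun σ hσ h0 => hlink σ hσ h0 _ (by omega)

theorem HH_subsingleton {n p q : ℤ} (hq : q < n)
    (hlink : ∀ σ ∈ K.faces, σ ≠ ∅ → ∀ i : ℤ, i ≠ n - (σ.card : ℤ) →
      Subsingleton (cohR G (K.link σ) i)) : Subsingleton (HH G K p q) := by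
  rw [Submodule.Quotient.subsingleton_iff, eq_top_iff]
  rintro ⟨a, ⟨ha, hk⟩, -⟩ -
  obtain ⟨b, hb, rfl⟩ := col_exact ha hk fun σ hσ h0 => hlink σ hσ h0 _ (by omega)
  exact ⟨Submodule.mem_sup_left ⟨b, hb, rfl⟩, ha⟩

theorem HH_top_equiv {n : ℤ} (hn : K.dim = n)
    (hlink : ∀ σ ∈ K.faces, σ ≠ ∅ → ∀ i : ℤ, i ≠ n - (σ.card : ℤ) →
      Subsingleton (cohR G (K.link σ) i)) (k : ℕ) :
    Nonempty (HH G K k n ≃+ coh G K (n - k)) := by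
  let X := bicomplex G K hlink
  have hkn : n - (k : ℤ) + k = n := sub_add_cancel _ _
  have hdv : ∀ {p : ℤ} {a : Pr → G}, a ∈ Ngr G K p n → dvL G K a = 0 := fun ha =>
    Ngr_eq_zero hn (dvL_mem ha) (Or.inr (lt_add_one n))
  refine nonempty_quotient_equiv_of_relation (X.stair (n - k) k) ?_ ?_ ?_
  · rintro ⟨a, c⟩ h
    have ha : a ∈ Ngr G K k n := by
      have : a ∈ Ngr G K k (n - k + k) := AugmentedBicomplex.fst_mem_of_mem_stair h
      rwa [hkn] at this
    refine ⟨⟨⟨ha, hdv ha⟩, ?_⟩, AugmentedBicomplex.snd_mem_of_mem_stair h, ?_, ?_⟩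
    · cases k with
      | zero => exact ⟨0, zero_mem _, by rw [map_zero, dhL_eq_zero ha]⟩
      | succ k =>
        obtain ⟨-, a', ha', haa⟩ := AugmentedBicomplex.mem_stair_succ.1 h
        have hm : a' ∈ Ngr G K k (n - (k + 1 : ℕ) + k) :=
          AugmentedBicomplex.fst_mem_of_mem_stair ha'
        have hk1 : ((k + 1 : ℕ) : ℤ) - 1 = k := by push_cast; ring
        have hkq : n - ((k + 1 : ℕ) : ℤ) + k = n - 1 := by push_cast; ring
        refine ⟨-a', neg_mem ?_, ?_⟩
        · rwa [hk1, ← hkq]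
        · rw [map_neg]
          exact (eq_neg_of_add_eq_zero_left haa).symm
    · rintro ⟨hB, -⟩
      obtain ⟨-, ⟨b, hb, rfl⟩, -, ⟨b', ⟨hb', -⟩, rfl⟩, hab⟩ := Submodule.mem_sup.1 hB
      refine AugmentedBicomplex.coboundary_of_stair h hkn.le (b := b) (b' := b') ?_ ?_ hab
      · rw [hkn]
        exact hb
      · rw [hkn]
        exact_mod_cast hb'
    · rintro ⟨d, hd, hdc⟩
      obtain ⟨b, hb, b', hb', hab⟩ := AugmentedBicomplex.boundary_of_stair h hd hdc
      rw [hkn] at hb hb'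
      have hb'' : b' ∈ Ngr G K ((k : ℤ) + 1) n := by exact_mod_cast hb'
      exact ⟨Submodule.mem_sup.2 ⟨_, ⟨b, hb, rfl⟩, _, ⟨b', ⟨hb'', hdv hb''⟩, rfl⟩, hab⟩, ha⟩
  · rintro a ⟨⟨ha, hk⟩, b, hb, hba⟩
    cases k with
    | zero =>
      have ha' : a ∈ Ngr G K 0 (n - (0 : ℕ)) := by simpa using ha
      refine ⟨augL G K a, AugmentedBicomplex.mem_stair_zero.2
        ⟨ha', augL_mem ha', ?_, rfl⟩⟩
      change cobL G K (augL G K a) = 0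
      rw [cobL_augL, LinearMap.mem_ker.1 hk, map_zero, neg_zero]
    | succ k =>
      have hk1 : ((k + 1 : ℕ) : ℤ) - 1 = k := by push_cast; ring
      have hkq : n - ((k + 1 : ℕ) : ℤ) + k = n - 1 := by push_cast; ring
      have hm : -b ∈ X.A k (n - (k + 1 : ℕ) + k) := by
        have hb' : b ∈ Ngr G K (((k + 1 : ℕ) : ℤ) - 1) (n - 1) := hb
        rw [hk1, ← hkq] at hb'
        exact neg_mem hb'
      have h : X.dh a + X.dv (-b) = 0 := by
        change dhL G K a + dvL G K (-b) = 0
        rw [map_neg, hba, add_neg_cancel]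
      obtain ⟨c, hc⟩ := AugmentedBicomplex.exists_stair_of_dh_add_dv hm (by push_cast; omega) h
      refine ⟨c, AugmentedBicomplex.mem_stair_succ.2 ⟨?_, -b, hc, h⟩⟩
      change a ∈ Ngr G K ((k + 1 : ℕ) : ℤ) _
      rw [hkq, sub_add_cancel]
      exact ha
  · rintro c ⟨hc, hk⟩
    exact AugmentedBicomplex.exists_stair_of_cocycle (X := X) hc hk k

theorem HH_equiv_of_neg {n p : ℤ} (hn : K.dim = n) (hp : p < 0) :
    Nonempty (HH G K p n ≃+ coh G K (n - p)) := by
  refine nonempty_quotient_equiv_of_relation ⊥ ?_ ?_ ?_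
  · rintro x hx
    rw [Submodule.mem_bot] at hx
    subst hx
    exact ⟨zero_mem _, zero_mem _, iff_of_true (zero_mem _) (zero_mem _)⟩
  · rintro a ⟨⟨ha, -⟩, -⟩
    exact ⟨0, by simp [Ngr_eq_zero hn ha (Or.inl hp)]⟩
  · rintro c ⟨hc, -⟩
    exact ⟨0, by simp [Cgr_eq_zero hn hc (by omega)]⟩

end SC

/-- If `K` is `n`-dimensional and for every nonempty simplex
`σ` the reduced cohomology of `link_K σ` with coefficients in `G` is
concentrated in degree `n - |σ|`, then `𝓗^{p,q}(K;G) = 0` for `q < n`, and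
`𝓗^{p,n}(K;G) ≅ H^{n-p}(K;G)`. -/
theorem HH_of_link_condition (G : Type) [AddCommGroup G] (K : SC) (n : ℤ)
    (hn : K.dim = n)
    (hlink : ∀ σ ∈ K.faces, σ ≠ ∅ → ∀ i : ℤ, i ≠ n - (σ.card : ℤ) →
      Subsingleton (SC.cohR G (K.link σ) i)) :
    (∀ p q : ℤ, q < n → Subsingleton (SC.HH G K p q)) ∧
    (∀ p : ℤ, Nonempty (SC.HH G K p n ≃+ SC.coh G K (n - p))) := by
  refine ⟨fun p q hq => SC.HH_subsingleton hq hlink, fun p => ?_⟩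
  rcases lt_or_ge p 0 with hp | hp
  · exact SC.HH_equiv_of_neg hn hp
  · lift p to ℕ using hp
    exact SC.HH_top_equiv hn hlink p
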